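/- Let f : ℝᵐ → ℝ be convex and continuous, let β₀ ∈ ℝᵐ and δ > 0, and suppose f(β₀) < f(β) for every β with ‖β − β₀‖ = δ. Then f attains a global minimum over ℝᵐ, and every global minimizer β* of f satisfies ‖β* − β₀‖ < δ. -/

import Mathlib

/-- If a convex continuous function on `ℝᵐ` is strictly larger on the sphere of radius `δ`
around `β₀` than at `β₀`, then it attains a global minimum, and every global minimizer lies
in the open ball of radius `δ` around `β₀`. -/
theorem convex_min_localization
    (m : ℕ) (f : EuclideanSpace ℝ (Fin m) → ℝ)
    (hconv : ConvexOn ℝ Set.univ f) (hf : Continuous f)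
    (β₀ : EuclideanSpace ℝ (Fin m)) (δ : ℝ) (hδ : 0 < δ)
    (hsphere : ∀ β, ‖β - β₀‖ = δ → f β₀ < f β) :
    (∃ βstar, ∀ β, f βstar ≤ f β) ∧
      ∀ βstar, (∀ β, f βstar ≤ f β) → ‖βstar - β₀‖ < δ := by
  have key : ∀ β, δ ≤ ‖β - β₀‖ → f β₀ < f β := by
    intro β hβ
    have hn : 0 < ‖β - β₀‖ := lt_of_lt_of_le hδ hβ
    obtain ⟨t, ht⟩ : ∃ t, t = δ / ‖β - β₀‖ := ⟨_, rfl⟩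
    have ht0 : 0 < t := ht ▸ div_pos hδ hn
    have ht1 : t ≤ 1 := ht ▸ (div_le_one hn).2 hβ
    have h1 := hconv.2 (Set.mem_univ β₀) (Set.mem_univ β) (sub_nonneg.2 ht1) ht0.le (by ring)
    have h2 : (1 - t) • β₀ + t • β - β₀ = t • (β - β₀) := by module
    have h3 := hsphere ((1 - t) • β₀ + t • β) (by
      rw [h2, norm_smul, Real.norm_of_nonneg ht0.le, ht]
      field_simp)
    simp only [smul_eq_mul] at h1
    have h4 : 0 < t * (f β - f β₀) := by linarith
    have h5 := pos_of_mul_pos_right h4 ht0.le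
    linarith
  refine ⟨?_, fun b hb => ?_⟩
  · obtain ⟨x, _, hx⟩ := (isCompact_closedBall β₀ δ).exists_isMinOn
      ⟨β₀, Metric.mem_closedBall_self hδ.le⟩ hf.continuousOn
    refine ⟨x, fun β => ?_⟩
    rcases le_total ‖β - β₀‖ δ with h | h
    · exact hx (mem_closedBall_iff_norm.2 h)
    · exact le_trans (hx (Metric.mem_closedBall_self hδ.le)) (key β h).le
  · by_contra h
    exact absurd (hb β₀) (not_le.2 (key b (not_lt.1 h)))
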